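/- Let Φ be a regular root system. Then the small Weyl graph Γ_s(Φ) is connected: any two Borel subsets of Φ are joined by a path in which consecutive Borel sets Φ_f, Φ_g are distinct and satisfy Φ_f ⊆ C_{f′} ∪ Φ_g and Φ_g ⊆ C_{g′} ∪ Φ_f for some f′, g′ ∈ F(Φ). -/

import Mathlib

section RootSystemDefs

variable {E : Type*} [AddCommGroup E] [Module ℝ E]

/-- A root system in a real vector space `E`: a finite subset that spans `E`,
does not contain `0`, and is closed under negation. -/
structure IsRootSystem (Φ : Set E) : Prop where
  finite : Φ.Finite
  spans : Submodule.span ℝ Φ = ⊤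
  zero_notMem : (0 : E) ∉ Φ
  neg_mem : ∀ α ∈ Φ, -α ∈ Φ

/-- `f ∈ F(Φ)`: a linear functional not vanishing on any root and taking
distinct values on distinct roots. -/
def IsRegularFunc (Φ : Set E) (f : E →ₗ[ℝ] ℝ) : Prop :=
  (∀ α ∈ Φ, f α ≠ 0) ∧ ∀ α ∈ Φ, ∀ β ∈ Φ, α ≠ β → f α ≠ f β

/-- The Borel set `Φ_f = {α ∈ Φ | f α > 0}`. -/
def borelSet (Φ : Set E) (f : E →ₗ[ℝ] ℝ) : Set E :=
  {α ∈ Φ | 0 < f α}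

/-- A Borel subset of `Φ`. -/
def IsBorelSet (Φ : Set E) (B : Set E) : Prop :=
  ∃ f : E →ₗ[ℝ] ℝ, IsRegularFunc Φ f ∧ B = borelSet Φ f

/-- Two Borel sets `B₁`, `B₂` are co-maximal if every Borel set containing
`B₁ ∩ B₂` equals `B₁` or `B₂`. -/
def CoMaximal (Φ : Set E) (B₁ B₂ : Set E) : Prop :=
  ∀ B : Set E, IsBorelSet Φ B → B₁ ∩ B₂ ⊆ B → B = B₁ ∨ B = B₂

/-- The boundary of the Borel set `Φ_f`. -/
def borelBoundary (Φ : Set E) (f : E →ₗ[ℝ] ℝ) : Set E :=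
  ⋃ B ∈ {B : Set E | IsBorelSet Φ B ∧ CoMaximal Φ (borelSet Φ f) B}, borelSet Φ f \ B

/-- The core of the Borel set `Φ_f`. -/
def borelCore (Φ : Set E) (f : E →ₗ[ℝ] ℝ) : Set E :=
  borelSet Φ f \ borelBoundary Φ f

/-- `Ψ` is a subsystem of `Φ` if `Ψ = Φ ∩ span ℝ Ψ`. -/
def IsSubsystem (Φ Ψ : Set E) : Prop :=
  Ψ = Φ ∩ (Submodule.span ℝ Ψ : Set E)

/-- Irreducibility of a root system. -/
def IsIrreducibleRS (Φ : Set E) : Prop :=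
  ¬ ∃ Φ₁ Φ₂ : Set E, Φ₁.Nonempty ∧ Φ₂.Nonempty ∧ Φ₁ ∪ Φ₂ = Φ ∧ Disjoint Φ₁ Φ₂ ∧
      Submodule.span ℝ Φ₁ ⊓ Submodule.span ℝ Φ₂ = ⊥

/-- The rank of a subset of `E` (the dimension of its span). -/
noncomputable def rankOf (Ψ : Set E) : ℕ := Module.finrank ℝ (Submodule.span ℝ Ψ)

/-- Regularity of a root system: every root lies in an irreducible rank-2 subsystem. -/
def IsRegularRS (Φ : Set E) : Prop :=
  ∀ α ∈ Φ, ∃ Ψ : Set E, IsSubsystem Φ Ψ ∧ IsIrreducibleRS Ψ ∧ rankOf Ψ = 2 ∧ α ∈ Ψ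

end RootSystemDefs

/-- Adjacency in the small Weyl graph `Γ_s(Φ)`: the vertices are the Borel subsets
of `Φ`, and two distinct Borel sets `Φ_f`, `Φ_g` are adjacent iff there exist
`f', g' ∈ F(Φ)` with `Φ_f ⊆ C_{f'} ∪ Φ_g` and `Φ_g ⊆ C_{g'} ∪ Φ_f`. -/
def SmallWeylAdj {E : Type*} [AddCommGroup E] [Module ℝ E]
    (Φ : Set E) (B₁ B₂ : Set E) : Prop :=
  IsBorelSet Φ B₁ ∧ IsBorelSet Φ B₂ ∧ B₁ ≠ B₂ ∧
    ∃ f' g' : E →ₗ[ℝ] ℝ, IsRegularFunc Φ f' ∧ IsRegularFunc Φ g' ∧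
      B₁ ⊆ borelCore Φ f' ∪ B₂ ∧ B₂ ⊆ borelCore Φ g' ∪ B₁

section Helpers

open Filter Topology

variable {E : Type*} [AddCommGroup E] [Module ℝ E]

/-- Small perturbations preserve positivity on a finite set. -/
lemma perturb_pos {Φ : Set E} (hfin : Φ.Finite) (k u : E →ₗ[ℝ] ℝ) :
    ∀ᶠ ε : ℝ in 𝓝[>] 0, ∀ α ∈ Φ, 0 < k α → 0 < (k + ε • u) α := by
  rw [hfin.eventually_all]
  intro α _
  by_cases h : 0 < k α
  · have h1 : Tendsto (fun ε : ℝ => (k + ε • u) α) (𝓝[>] 0) (𝓝 (k α)) := by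
      have : Continuous (fun ε : ℝ => (k + ε • u) α) := by
        simp only [LinearMap.add_apply, LinearMap.smul_apply, smul_eq_mul]
        fun_prop
      have h2 := this.tendsto 0
      simp only [zero_smul, add_zero] at h2
      exact h2.mono_left nhdsWithin_le_nhds
    filter_upwards [h1.eventually (lt_mem_nhds h)] with ε hε _ using hε
  · exact Eventually.of_forall fun _ h' => absurd h' h

/-- A generic small perturbation does not vanish at a vector where `u` does not vanish. -/
lemma perturb_ne (k u : E →ₗ[ℝ] ℝ) (v : E) (hv : u v ≠ 0) :
    ∀ᶠ ε : ℝ in 𝓝[>] 0, (k + ε • u) v ≠ 0 := by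
  have h1 : ∀ᶠ ε : ℝ in 𝓝[>] 0, ε < |k v| / |u v| ∨ k v = 0 := by
    by_cases hk : k v = 0
    · exact Eventually.of_forall fun _ => Or.inr hk
    · have : 0 < |k v| / |u v| := div_pos (abs_pos.2 hk) (abs_pos.2 hv)
      filter_upwards [nhdsWithin_le_nhds (gt_mem_nhds this)] with ε hε using Or.inl hε
  filter_upwards [h1, self_mem_nhdsWithin] with ε h1 (h2 : 0 < ε) h3
  simp only [LinearMap.add_apply, LinearMap.smul_apply, smul_eq_mul] at h3
  rcases h1 with h1 | h1
  · rw [lt_div_iff₀ (abs_pos.2 hv)] at h1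
    have h4 : k v = -(ε * u v) := by linarith
    rw [h4, abs_neg, abs_mul, abs_of_pos h2] at h1
    exact lt_irrefl _ h1
  · rw [h1, zero_add] at h3
    exact (mul_ne_zero h2.ne' hv) h3

/-- Regular functionals exist. -/
lemma exists_regular {Φ : Set E} (hΦ : IsRootSystem Φ) :
    ∃ u : E →ₗ[ℝ] ℝ, IsRegularFunc Φ u := by
  have := hΦ.finite.to_subtype
  obtain ⟨u, hu⟩ := Module.exists_dual_forall_apply_ne_zero (K := ℝ) (M := E)
    (ι := Φ ⊕ {p : Φ × Φ // p.1 ≠ p.2})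
    (Sum.elim (fun a => (a : E)) (fun p => (p.1.1 : E) - p.1.2)) (by
      rintro (a | ⟨p, hp⟩)
      · intro h
        exact hΦ.zero_notMem (by simpa [← h] using a.2)
      · intro h
        exact hp (Subtype.ext (sub_eq_zero.1 h)))
  refine ⟨u, fun α hα => hu (Sum.inl ⟨α, hα⟩), fun α hα β hβ hne h => ?_⟩
  refine hu (Sum.inr ⟨(⟨α, hα⟩, ⟨β, hβ⟩), fun h' => hne (congrArg Subtype.val h')⟩) ?_
  simp [h]

/-- Every functional can be perturbed to a regular one. -/
lemma exists_regular_perturb {Φ : Set E} (hΦ : IsRootSystem Φ) (k : E →ₗ[ℝ] ℝ) :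
    ∃ h : E →ₗ[ℝ] ℝ, IsRegularFunc Φ h ∧ ∀ α ∈ Φ, 0 < k α → 0 < h α := by
  obtain ⟨u, hu0, hu1⟩ := exists_regular hΦ
  have e1 : ∀ᶠ ε : ℝ in 𝓝[>] 0, ∀ α ∈ Φ, (k + ε • u) α ≠ 0 :=
    hΦ.finite.eventually_all.2 fun α hα => perturb_ne k u α (hu0 α hα)
  have e2 : ∀ᶠ ε : ℝ in 𝓝[>] 0, ∀ α ∈ Φ, ∀ β ∈ Φ, α ≠ β → (k + ε • u) (α - β) ≠ 0 := by
    refine hΦ.finite.eventually_all.2 fun α hα => hΦ.finite.eventually_all.2 fun β hβ => ?_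
    by_cases h : α = β
    · exact Eventually.of_forall fun _ h' => absurd h h'
    · have : u (α - β) ≠ 0 := by
        rw [map_sub]
        exact sub_ne_zero.2 (hu1 α hα β hβ h)
      filter_upwards [perturb_ne k u _ this] with ε hε _ using hε
  obtain ⟨ε, h1, h2, h3⟩ := (e1.and (e2.and (perturb_pos hΦ.finite k u))).exists
  refine ⟨k + ε • u, ⟨h1, fun α hα β hβ hne h => h2 α hα β hβ hne ?_⟩, h3⟩
  rw [map_sub, h, sub_self]

lemma neg_of_perturb {Φ : Set E} (hΦ : IsRootSystem Φ) {k h : E →ₗ[ℝ] ℝ}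
    (H : ∀ α ∈ Φ, 0 < k α → 0 < h α) {α : E} (hα : α ∈ Φ) (hk : k α < 0) : h α < 0 := by
  have := H (-α) (hΦ.neg_mem α hα) (by simpa using hk)
  simpa using this

/-- A functional with values of opposite sign on two independent vectors. -/
lemma exists_sep {α β : E} (h : LinearIndependent ℝ ![α, β]) :
    ∃ u : E →ₗ[ℝ] ℝ, u α = 1 ∧ u β = -1 := by
  have h' : LinearIndependent ℝ ![α, -β] := by
    rw [LinearIndependent.pair_iff] at h ⊢
    intro s t hst
    have := h s (-t) (by simpa using hst)
    simpa using this
  obtain ⟨u, hu⟩ := Module.exists_dual_forall_apply_eq_one (linearIndepOn_univ_iff.2 h')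
  refine ⟨u, by simpa using hu 0 (Set.mem_univ _), ?_⟩
  have := hu 1 (Set.mem_univ _)
  simp at this
  linarith

/-- Two roots separating co-maximal Borel sets are linearly dependent. -/
lemma comaximal_dep {Φ : Set E} (hΦ : IsRootSystem Φ) {f g : E →ₗ[ℝ] ℝ}
    (hcm : CoMaximal Φ (borelSet Φ f) (borelSet Φ g)) {α β : E} (hα : α ∈ Φ) (hβ : β ∈ Φ)
    (fα : 0 < f α) (gα : g α < 0) (fβ : 0 < f β) (gβ : g β < 0) :
    ¬ LinearIndependent ℝ ![α, β] := by
  intro hli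
  obtain ⟨u, uα, uβ⟩ := exists_sep hli
  set k : E →ₗ[ℝ] ℝ := (-g α) • f + (f α) • g with hk
  have kα : k α = 0 := by simp [hk]; ring
  have kpos : ∀ γ ∈ borelSet Φ f ∩ borelSet Φ g, 0 < k γ := by
    rintro γ ⟨⟨_, h1⟩, ⟨_, h2⟩⟩
    have a1 := mul_pos (neg_pos.2 gα) h1
    have a2 := mul_pos fα h2
    simp only [hk, LinearMap.add_apply, LinearMap.smul_apply, smul_eq_mul]
    linarith
  -- a functional which is positive on the intersection with opposite signs at `α` and `β`
  obtain ⟨m, mpos, hm⟩ : ∃ m : E →ₗ[ℝ] ℝ, (∀ γ ∈ borelSet Φ f ∩ borelSet Φ g, 0 < m γ) ∧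
      ((m α < 0 ∧ 0 < m β) ∨ (0 < m α ∧ m β < 0)) := by
    rcases le_or_gt 0 (k β) with hb | hb
    · obtain ⟨ε, h1, h2⟩ := ((perturb_pos hΦ.finite k (-u)).and self_mem_nhdsWithin).exists
      have h2 : 0 < ε := h2
      refine ⟨k + ε • (-u), fun γ hγ => h1 γ hγ.1.1 (kpos γ hγ), Or.inl ⟨?_, ?_⟩⟩
      · simp [kα, uα, h2]
      · simp [uβ]; linarith
    · obtain ⟨ε, h1, h2⟩ := ((perturb_pos hΦ.finite k u).and self_mem_nhdsWithin).exists
      have h2 : 0 < ε := h2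
      refine ⟨k + ε • u, fun γ hγ => h1 γ hγ.1.1 (kpos γ hγ), Or.inr ⟨?_, ?_⟩⟩
      · simp [kα, uα, h2]
      · simp [uβ]; linarith
  obtain ⟨h, hr, hh⟩ := exists_regular_perturb hΦ m
  have hcase := hcm (borelSet Φ h) ⟨h, hr, rfl⟩
    (fun γ hγ => ⟨hγ.1.1, hh γ hγ.1.1 (mpos γ hγ)⟩)
  have af : α ∈ borelSet Φ f := ⟨hα, fα⟩
  have bf : β ∈ borelSet Φ f := ⟨hβ, fβ⟩
  have ag : α ∉ borelSet Φ g := fun h => lt_asymm h.2 gα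
  have bg : β ∉ borelSet Φ g := fun h => lt_asymm h.2 gβ
  rcases hm with ⟨m1, m2⟩ | ⟨m1, m2⟩
  · have h1 : α ∉ borelSet Φ h := fun h' => lt_asymm h'.2 (neg_of_perturb hΦ hh hα m1)
    have h2 : β ∈ borelSet Φ h := ⟨hβ, hh β hβ m2⟩
    rcases hcase with e | e
    · exact h1 (e ▸ af)
    · exact bg (e ▸ h2)
  · have h1 : β ∉ borelSet Φ h := fun h' => lt_asymm h'.2 (neg_of_perturb hΦ hh hβ m2)
    have h2 : α ∈ borelSet Φ h := ⟨hα, hh α hα m1⟩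
    rcases hcase with e | e
    · exact h1 (e ▸ bf)
    · exact ag (e ▸ h2)

/-- In a regular root system each root is a positive combination of two others. -/
lemma exists_decomp {Φ : Set E} (hΦ : IsRootSystem Φ) (hreg : IsRegularRS Φ) {α : E}
    (hα : α ∈ Φ) : ∃ β ∈ Φ, ∃ γ ∈ Φ, ∃ a b : ℝ, 0 < a ∧ 0 < b ∧ α = a • β + b • γ ∧
      LinearIndependent ℝ ![β, γ] := by
  obtain ⟨Ψ, hsub, hirr, hrank, hαΨ⟩ := hreg α hα
  have hΨ : Ψ ⊆ Φ := fun x hx => (hsub ▸ hx : x ∈ Φ ∩ _).1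
  have hne : ∀ x ∈ Ψ, x ≠ 0 := fun x hx h => hΦ.zero_notMem (h ▸ hΨ hx)
  have hα0 := hne α hαΨ
  -- a second direction
  obtain ⟨β, hβΨ, hβ⟩ : ∃ β ∈ Ψ, β ∉ Submodule.span ℝ {α} := by
    by_contra! hcon
    have hle : Submodule.span ℝ Ψ ≤ Submodule.span ℝ {α} := Submodule.span_le.2 hcon
    have := Submodule.finrank_mono hle
    rw [finrank_span_singleton hα0] at this
    unfold rankOf at hrank
    omega
  have hli : LinearIndependent ℝ ![α, β] := by
    rw [LinearIndependent.pair_iff' hα0]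
    intro a h
    exact hβ (Submodule.mem_span_singleton.2 ⟨a, h⟩)
  have hβ0 := hne β hβΨ
  -- a third direction
  obtain ⟨γ, hγΨ, hγα, hγβ⟩ : ∃ γ ∈ Ψ, γ ∉ Submodule.span ℝ {α} ∧ γ ∉ Submodule.span ℝ {β} := by
    by_contra! hcon
    have hdisj : ∀ x, x ∈ Submodule.span ℝ {α} → x ∈ Submodule.span ℝ {β} → x = 0 := by
      intro x h1 h2
      obtain ⟨s, rfl⟩ := Submodule.mem_span_singleton.1 h1
      obtain ⟨t, ht⟩ := Submodule.mem_span_singleton.1 h2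
      have := LinearIndependent.pair_iff.1 hli s (-t) (by rw [← ht]; simp)
      simp [this.1]
    refine hirr ⟨Ψ ∩ Submodule.span ℝ {α}, Ψ ∩ Submodule.span ℝ {β},
      ⟨α, hαΨ, Submodule.mem_span_singleton_self α⟩,
      ⟨β, hβΨ, Submodule.mem_span_singleton_self β⟩, ?_, ?_, ?_⟩
    · ext x
      constructor
      · rintro (h | h)
        · exact h.1
        · exact h.1
      · intro h
        by_cases h' : x ∈ Submodule.span ℝ {α}
        · exact Or.inl ⟨h, h'⟩
        · exact Or.inr ⟨h, hcon x h h'⟩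
    · rw [Set.disjoint_left]
      rintro x ⟨hx, h1⟩ ⟨_, h2⟩
      exact hne x hx (hdisj x h1 h2)
    · rw [eq_bot_iff]
      rintro x ⟨h1, h2⟩
      have hxa := (Submodule.span_le.2 (fun y hy => hy.2) :
        Submodule.span ℝ (Ψ ∩ Submodule.span ℝ {α}) ≤ Submodule.span ℝ {α}) h1
      have hxb := (Submodule.span_le.2 (fun y hy => hy.2) :
        Submodule.span ℝ (Ψ ∩ Submodule.span ℝ {β}) ≤ Submodule.span ℝ {β}) h2
      exact (Submodule.mem_bot ℝ).2 (hdisj x hxa hxb)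
  -- the span is generated by `α` and `β`
  have hfd : FiniteDimensional ℝ (Submodule.span ℝ Ψ) :=
    FiniteDimensional.span_of_finite ℝ (hΦ.finite.subset hΨ)
  have hspan : Submodule.span ℝ (Set.range ![α, β]) = Submodule.span ℝ Ψ := by
    apply Submodule.eq_of_le_of_finrank_eq
    · apply Submodule.span_mono
      rintro x ⟨i, rfl⟩
      fin_cases i
      · exact hαΨ
      · exact hβΨ
    · rw [finrank_span_eq_card hli]
      exact hrank.symm
  have hγs : γ ∈ Submodule.span ℝ ({α, β} : Set E) := by
    have : γ ∈ Submodule.span ℝ Ψ := Submodule.subset_span hγΨ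
    rw [← hspan] at this
    simpa [Set.pair_comm] using this
  obtain ⟨x, y, hxy⟩ := Submodule.mem_span_pair.1 hγs
  have hx : x ≠ 0 := by
    rintro rfl
    exact hγβ (Submodule.mem_span_singleton.2 ⟨y, by simpa using hxy⟩)
  have hy : y ≠ 0 := by
    rintro rfl
    exact hγα (Submodule.mem_span_singleton.2 ⟨x, by simpa using hxy⟩)
  have key : ∀ (z : E) (c : ℝ), z ∈ Φ → c ≠ 0 → ∃ z' ∈ Φ, ∃ c' : ℝ, 0 < c' ∧ c • z = c' • z' ∧
      (z' = z ∨ z' = -z) := by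
    intro z c hz hc
    rcases lt_or_gt_of_ne hc with h | h
    · exact ⟨-z, hΦ.neg_mem z hz, -c, by linarith, by simp, Or.inr rfl⟩
    · exact ⟨z, hz, c, h, rfl, Or.inl rfl⟩
  obtain ⟨β', hβ', a, ha, hae, hbb⟩ := key β (-(x⁻¹ * y)) (hΨ hβΨ)
    (neg_ne_zero.2 (mul_ne_zero (inv_ne_zero hx) hy))
  obtain ⟨γ', hγ', b, hb, hbe, hcc⟩ := key γ x⁻¹ (hΨ hγΨ) (inv_ne_zero hx)
  refine ⟨β', hβ', γ', hγ', a, b, ha, hb, ?_, ?_⟩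
  · rw [← hae, ← hbe, ← hxy, smul_add, smul_smul, smul_smul, inv_mul_cancel₀ hx]
    simp
  · rw [LinearIndependent.pair_iff' (hne β hβΨ |> fun h => by rcases hbb with rfl | rfl <;> simpa using h)]
    intro t ht
    apply hγβ
    rw [Submodule.mem_span_singleton]
    rcases hbb with rfl | rfl <;> rcases hcc with rfl | rfl
    · exact ⟨t, ht⟩
    · exact ⟨-t, by rw [neg_smul, ht, neg_neg]⟩
    · exact ⟨-t, by rw [← ht]; simp⟩
    · exact ⟨t, by rw [smul_neg] at ht; exact neg_injective ht⟩

/-- Every root, with all its positive multiples, lies in some core. -/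
lemma exists_core {Φ : Set E} (hΦ : IsRootSystem Φ) (hreg : IsRegularRS Φ) {α : E}
    (hα : α ∈ Φ) : ∃ f : E →ₗ[ℝ] ℝ, IsRegularFunc Φ f ∧
      ∀ c : ℝ, 0 < c → c • α ∈ Φ → c • α ∈ borelCore Φ f := by
  obtain ⟨β, hβ, γ, hγ, a, b, ha, hb, hab, hli⟩ := exists_decomp hΦ hreg hα
  obtain ⟨u, hu⟩ := Module.exists_dual_forall_apply_eq_one (linearIndepOn_univ_iff.2 hli)
  have u1 : u β = 1 := by simpa using hu 0 (Set.mem_univ _)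
  have u2 : u γ = 1 := by simpa using hu 1 (Set.mem_univ _)
  obtain ⟨f, hf, hpos⟩ := exists_regular_perturb hΦ u
  have fβ : 0 < f β := hpos β hβ (by rw [u1]; exact one_pos)
  have fγ : 0 < f γ := hpos γ hγ (by rw [u2]; exact one_pos)
  have fα : 0 < f α := by
    rw [hab]
    simp only [map_add, map_smul, smul_eq_mul]
    positivity
  refine ⟨f, hf, fun c hc hcα => ?_⟩
  have fcα : 0 < f (c • α) := by
    rw [map_smul, smul_eq_mul]
    positivity
  refine ⟨⟨hcα, fcα⟩, ?_⟩
  intro hmem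
  simp only [borelBoundary, Set.mem_iUnion] at hmem
  obtain ⟨B, ⟨⟨g, hg, rfl⟩, hcm⟩, -, hnot⟩ := hmem
  have gcα : g (c • α) < 0 := by
    rcases lt_or_gt_of_ne (hg.1 _ hcα) with h | h
    · exact h
    · exact absurd ⟨hcα, h⟩ hnot
  have gα : g α < 0 := by
    rw [map_smul, smul_eq_mul] at gcα
    by_contra! h
    exact absurd (mul_nonneg hc.le h) (not_le.2 gcα)
  rw [LinearIndependent.pair_iff] at hli
  rcases lt_or_ge (g β) 0 with gβ | gβ
  · refine comaximal_dep hΦ hcm hα hβ fα gα fβ gβ (LinearIndependent.pair_iff.2 ?_)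
    intro s t hst
    obtain ⟨h1, h2⟩ := hli (s * a + t) (s * b) (by rw [← hst, hab]; module)
    have : s = 0 := by simpa [hb.ne'] using h2
    subst this
    simpa using h1
  · have gγ : g γ < 0 := by
      rw [hab] at gα
      simp only [map_add, map_smul, smul_eq_mul] at gα
      by_contra! h
      have := mul_nonneg hb.le h
      have := mul_nonneg ha.le gβ
      linarith
    refine comaximal_dep hΦ hcm hα hγ fα gα fγ gγ (LinearIndependent.pair_iff.2 ?_)
    intro s t hst
    obtain ⟨h1, h2⟩ := hli (s * a) (s * b + t) (by rw [← hst, hab]; module)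
    have : s = 0 := by simpa [ha.ne'] using h1
    subst this
    simpa using h2

/-- For regular `f`, a root outside the Borel set has negative value. -/
lemma neg_of_notMem {Φ : Set E} {f : E →ₗ[ℝ] ℝ} (hf : IsRegularFunc Φ f) {α : E} (hα : α ∈ Φ)
    (h : α ∉ borelSet Φ f) : f α < 0 := by
  rcases lt_or_gt_of_ne (hf.1 α hα) with h' | h'
  · exact h'
  · exact absurd ⟨hα, h'⟩ h

/-- One side of the adjacency condition for distinct co-maximal Borel sets. -/
lemma subset_core_union {Φ : Set E} (hΦ : IsRootSystem Φ) (hreg : IsRegularRS Φ)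
    {f g : E →ₗ[ℝ] ℝ} (hg : IsRegularFunc Φ g)
    (hcm : CoMaximal Φ (borelSet Φ f) (borelSet Φ g)) :
    ∃ f' : E →ₗ[ℝ] ℝ, IsRegularFunc Φ f' ∧ borelSet Φ f ⊆ borelCore Φ f' ∪ borelSet Φ g := by
  by_cases hsub : borelSet Φ f ⊆ borelSet Φ g
  · exact ⟨g, hg, fun x hx => Or.inr (hsub hx)⟩
  obtain ⟨α, ⟨hα, fα⟩, hαg⟩ := Set.not_subset.1 hsub
  have gα := neg_of_notMem hg hα hαg
  obtain ⟨f', hf', hcore⟩ := exists_core hΦ hreg hα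
  refine ⟨f', hf', ?_⟩
  rintro β ⟨hβ, fβ⟩
  by_cases hβg : β ∈ borelSet Φ g
  · exact Or.inr hβg
  have gβ := neg_of_notMem hg hβ hβg
  have hdep := comaximal_dep hΦ hcm hα hβ fα gα fβ gβ
  rw [LinearIndependent.pair_iff' (fun h => hΦ.zero_notMem (h ▸ hα))] at hdep
  push Not at hdep
  obtain ⟨c, rfl⟩ := hdep
  rw [map_smul, smul_eq_mul] at fβ
  exact Or.inl (hcore c (pos_of_mul_pos_left fβ fα.le) hβ)

lemma borel_eq_of_subset {Φ : Set E} (hΦ : IsRootSystem Φ) {f g : E →ₗ[ℝ] ℝ}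
    (hf : IsRegularFunc Φ f) (h : borelSet Φ f ⊆ borelSet Φ g) :
    borelSet Φ f = borelSet Φ g := by
  refine h.antisymm fun x hx => ?_
  by_contra hn
  have h1 := neg_of_notMem hf hx.1 hn
  have h2 := h (show -x ∈ borelSet Φ f from ⟨hΦ.neg_mem x hx.1, by simpa using h1⟩)
  have h3 := h2.2
  have h4 := hx.2
  rw [map_neg] at h3
  linarith

lemma connected_aux {Φ : Set E} (hΦ : IsRootSystem Φ) (hreg : IsRegularRS Φ) (n : ℕ) :
    ∀ f g : E →ₗ[ℝ] ℝ, IsRegularFunc Φ f → IsRegularFunc Φ g →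
      (borelSet Φ f \ borelSet Φ g).ncard ≤ n →
      Relation.ReflTransGen (SmallWeylAdj Φ) (borelSet Φ f) (borelSet Φ g) := by
  induction n with
  | zero =>
    intro f g hf hg hn
    have hfin : (borelSet Φ f \ borelSet Φ g).Finite := hΦ.finite.subset fun x hx => hx.1.1
    have h0 := (Set.ncard_eq_zero hfin).1 (Nat.le_zero.1 hn)
    rw [borel_eq_of_subset hΦ hf (Set.sdiff_eq_empty.1 h0)]
  | succ n ih =>
    intro f g hf hg hn
    by_cases heq : borelSet Φ f = borelSet Φ g
    · rw [heq]
    have hfin : (borelSet Φ f \ borelSet Φ g).Finite := hΦ.finite.subset fun x hx => hx.1.1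
    by_cases hcm : CoMaximal Φ (borelSet Φ f) (borelSet Φ g)
    · have hcm' : CoMaximal Φ (borelSet Φ g) (borelSet Φ f) := fun B hB h =>
        (hcm B hB (by rwa [Set.inter_comm])).symm
      obtain ⟨f', hf', h1⟩ := subset_core_union hΦ hreg hg hcm
      obtain ⟨g', hg', h2⟩ := subset_core_union hΦ hreg hf hcm'
      exact Relation.ReflTransGen.single
        ⟨⟨f, hf, rfl⟩, ⟨g, hg, rfl⟩, heq, f', g', hf', hg', h1, h2⟩
    · unfold CoMaximal at hcm
      push Not at hcm
      obtain ⟨B, ⟨h, hh, rfl⟩, hsub, hne1, hne2⟩ := hcm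
      have hneg : ∀ {k : E →ₗ[ℝ] ℝ} {x : E}, IsRegularFunc Φ k → x ∈ Φ → x ∉ borelSet Φ k →
          -x ∈ borelSet Φ k := fun hk hx hn =>
        ⟨hΦ.neg_mem _ hx, by simpa using neg_of_notMem hk hx hn⟩
      have hnn : ∀ {k : E →ₗ[ℝ] ℝ} {x : E}, x ∈ borelSet Φ k → -x ∉ borelSet Φ k := by
        intro k x h1 h2
        have h3 := h2.2
        have h4 := h1.2
        rw [map_neg] at h3
        linarith
      have s1 : borelSet Φ f \ borelSet Φ h ⊂ borelSet Φ f \ borelSet Φ g := by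
        refine ⟨fun x hx => ⟨hx.1, fun hxg => hx.2 (hsub ⟨hx.1, hxg⟩)⟩, fun hcon => hne2 ?_⟩
        refine (borel_eq_of_subset hΦ hg fun x hx => ?_).symm
        by_contra hxh
        by_cases hxf : x ∈ borelSet Φ f
        · exact hxh (hsub ⟨hxf, hx⟩)
        · exact (hcon ⟨hneg hf hx.1 hxf, hnn hx⟩).2 (hneg hh hx.1 hxh)
      have s2 : borelSet Φ h \ borelSet Φ g ⊂ borelSet Φ f \ borelSet Φ g := by
        refine ⟨fun x hx => ⟨?_, hx.2⟩, fun hcon => hne1 ?_⟩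
        · by_contra hxf
          exact hnn hx.1 (hsub ⟨hneg hf hx.1.1 hxf, hneg hg hx.1.1 hx.2⟩)
        · refine (borel_eq_of_subset hΦ hf fun x hx => ?_).symm
          by_cases hxg : x ∈ borelSet Φ g
          · exact hsub ⟨hx, hxg⟩
          · exact (hcon ⟨hx, hxg⟩).1
      have c1 := Set.ncard_lt_ncard s1 hfin
      have c2 := Set.ncard_lt_ncard s2 hfin
      exact (ih f h hf hh (by omega)).trans (ih h g hh hg (by omega))

end Helpers

/-- Lemma: if `Φ` is a regular root system, then the small Weyl graph `Γ_s(Φ)` is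
connected: any two Borel subsets are joined by a path of small-Weyl-graph edges. -/
theorem statement5 {E : Type*} [AddCommGroup E] [Module ℝ E] [FiniteDimensional ℝ E]
    (Φ : Set E) (hΦ : IsRootSystem Φ) (hreg : IsRegularRS Φ) :
    ∀ B₁ B₂ : Set E, IsBorelSet Φ B₁ → IsBorelSet Φ B₂ →
      Relation.ReflTransGen (SmallWeylAdj Φ) B₁ B₂ := by
  rintro _ _ ⟨f, hf, rfl⟩ ⟨g, hg, rfl⟩
  exact connected_aux hΦ hreg _ f g hf hg le_rfl
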